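/- Let f be analytic on the open unit disk 𝔻 ⊂ ℂ with |f(z)| ≤ 1 for all z ∈ 𝔻, write f(z) = Σ_{n=0}^∞ a_n z^n, let a = |a₀| < 1 and p > 0, and define A_{a,p}(r) = [1 − (2 − a²)r](1 + a r)^p − (1 − r)(r + a)^p. Then for every z ∈ 𝔻 with |z| = r, where r ∈ [0,1) satisfies A_{a,p}(r) ≥ 0, one has |f(z)|^p + Σ_{n=1}^∞ |a_n| r^n + (1/(1+a) + r/(1−r)) · Σ_{n=1}^∞ |a_n|² r^{2n} ≤ 1. -/

import Mathlib

theorem fourier_natCast_apply_eq_pow {T : ℝ} (n : ℕ) (x : AddCircle T) :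
    fourier (n : ℤ) x = (fourier 1 x) ^ n := by
  simp [fourier_apply, AddCircle.toCircle_nsmul]

/-- Comparison of the coefficient `ℓ²` norms of two power series, the second one a polynomial,
of which one dominates the other on the unit circle. -/
theorem sum_sq_norm_le_of_norm_tsum_le {d e : ℕ → ℂ} {M : ℕ} (hd : Summable fun n ↦ ‖d n‖)
    (h : ∀ w : ℂ, ‖w‖ = 1 → ‖∑' n, d n * w ^ n‖ ≤ ‖∑ n ∈ Finset.range M, e n * w ^ n‖)
    (s : Finset ℕ) : ∑ n ∈ s, ‖d n‖ ^ 2 ≤ ∑ n ∈ Finset.range M, ‖e n‖ ^ 2 := by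
  let φ : ℕ → C(UnitAddCircle, ℂ) := fun n ↦ fourier (n : ℤ)
  have hφ (n : ℕ) : ‖φ n‖ = 1 := fourier_norm _
  have hsF : Summable fun n ↦ d n • φ n :=
    Summable.of_norm (by simpa [norm_smul, hφ] using hd)
  let Λ := ContinuousMap.toLp (E := ℂ) 2 (AddCircle.haarAddCircle (T := (1 : ℝ))) ℂ
  have hon : Orthonormal ℂ fun n ↦ Λ (φ n) :=
    orthonormal_fourier.comp (fun n : ℕ ↦ (n : ℤ)) Nat.cast_injective
  have hΛ : HasSum (fun n ↦ d n • Λ (φ n)) (Λ (∑' n, d n • φ n)) := by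
    simpa using hsF.hasSum.mapL Λ
  have hcoeff (k : ℕ) : inner ℂ (Λ (φ k)) (Λ (∑' n, d n • φ n)) = d k := by
    have hk : (fun n ↦ innerSL ℂ (Λ (φ k)) (d n • Λ (φ n))) = fun n ↦ if n = k then d k else 0 := by
      ext1 n
      rw [innerSL_apply_apply, inner_smul_right, orthonormal_iff_ite.mp hon k n]
      aesop
    exact (hΛ.mapL (innerSL ℂ (Λ (φ k)))).unique (hk ▸ hasSum_ite_eq k (d k))
  have hnorm : ‖Λ (∑' n, d n • φ n)‖ ≤ ‖Λ (∑ n ∈ Finset.range M, e n • φ n)‖ := by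
    refine MeasureTheory.Lp.norm_le_norm_of_ae_le ?_
    filter_upwards [ContinuousMap.coeFn_toLp (p := 2) (𝕜 := ℂ) AddCircle.haarAddCircle
        (∑' n, d n • φ n),
      ContinuousMap.coeFn_toLp (p := 2) (𝕜 := ℂ) AddCircle.haarAddCircle
        (∑ n ∈ Finset.range M, e n • φ n)] with x hx hx'
    rw [hx, hx', ← ContinuousMap.tsum_apply hsF x]
    simp only [φ, ContinuousMap.coe_sum, Finset.sum_apply, ContinuousMap.smul_apply, smul_eq_mul,
      fourier_natCast_apply_eq_pow]
    exact h (fourier 1 x) (Circle.norm_coe _)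
  have hpoly : ‖Λ (∑ n ∈ Finset.range M, e n • φ n)‖ ^ 2 = ∑ n ∈ Finset.range M, ‖e n‖ ^ 2 := by
    have := hon.inner_sum e e (Finset.range M)
    simp only [map_sum, map_smul]
    rw [@norm_sq_eq_re_inner ℂ, this]
    simp [← Complex.normSq_eq_conj_mul_self, Complex.normSq_eq_norm_sq, -Complex.ofReal_pow]
  calc ∑ n ∈ s, ‖d n‖ ^ 2
      = ∑ n ∈ s, ‖inner ℂ (Λ (φ n)) (Λ (∑' n, d n • φ n))‖ ^ 2 := by simp [hcoeff]
    _ ≤ ‖Λ (∑' n, d n • φ n)‖ ^ 2 := hon.sum_inner_products_le _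
    _ ≤ ‖Λ (∑ n ∈ Finset.range M, e n • φ n)‖ ^ 2 := by gcongr
    _ = _ := hpoly

/-- Multiplication by a function bounded by one contracts the coefficient `ℓ²` norm. -/
theorem sum_sq_norm_conv_le {f : ℂ → ℂ} {c : ℕ → ℂ}
    (hsum : ∀ z ∈ Metric.ball (0 : ℂ) 1, HasSum (fun n : ℕ => c n * z ^ n) (f z))
    (hb : ∀ z ∈ Metric.ball (0 : ℂ) 1, ‖f z‖ ≤ 1) {q : ℕ → ℂ} {M : ℕ}
    (hq : ∀ n, M ≤ n → q n = 0) (s : Finset ℕ) :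
    ∑ n ∈ s, ‖∑ k ∈ Finset.range (n + 1), q k * c (n - k)‖ ^ 2 ≤
      ∑ n ∈ Finset.range M, ‖q n‖ ^ 2 := by
  have key : ∀ ρ ∈ Set.Ioo (0 : ℝ) 1,
      ∑ n ∈ s, ‖(∑ k ∈ Finset.range (n + 1), q k * c (n - k)) * (ρ : ℂ) ^ n‖ ^ 2 ≤
        ∑ n ∈ Finset.range M, ‖q n * (ρ : ℂ) ^ n‖ ^ 2 := by
    intro ρ hρ
    have hconv (w : ℂ) (n : ℕ) :
        ((∑ k ∈ Finset.range (n + 1), q k * c (n - k)) * (ρ : ℂ) ^ n) * w ^ n =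
          ∑ k ∈ Finset.range (n + 1), (q k * (ρ * w) ^ k) * (c (n - k) * (ρ * w) ^ (n - k)) := by
      rw [mul_assoc, ← mul_pow, Finset.sum_mul]
      refine Finset.sum_congr rfl fun k hk ↦ ?_
      rw [← Nat.add_sub_of_le (Finset.mem_range_succ_iff.mp hk)]
      simp only [add_tsub_cancel_left, pow_add]
      ring
    have hqs (w : ℂ) : Summable fun n ↦ ‖q n * (ρ * w) ^ n‖ :=
      summable_of_ne_finset_zero (s := Finset.range M) fun n hn ↦ by
        simp [hq n (by simpa using hn)]
    have hmem (w : ℂ) (hw : ‖w‖ = 1) : (ρ * w : ℂ) ∈ Metric.ball (0 : ℂ) 1 := by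
      simp [hw, abs_of_pos hρ.1, hρ.2]
    have hcs (w : ℂ) (hw : ‖w‖ = 1) : Summable fun n ↦ ‖c n * (ρ * w) ^ n‖ :=
      (hsum _ (hmem w hw)).summable.norm
    refine sum_sq_norm_le_of_norm_tsum_le ?_ (fun w hw ↦ ?_) s
    · have := summable_norm_sum_mul_range_of_summable_norm (hqs 1) (hcs 1 (by simp))
      exact this.congr fun n ↦ by rw [← hconv 1 n, one_pow, mul_one]
    · have hP : ∑' n, q n * (ρ * w) ^ n = ∑ n ∈ Finset.range M, q n * (ρ * w) ^ n :=
        tsum_eq_sum fun n hn ↦ by simp [hq n (by simpa using hn)]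
      simp only [hconv]
      rw [← tsum_mul_tsum_eq_tsum_sum_range_of_summable_norm (hqs w) (hcs w hw),
        (hsum _ (hmem w hw)).tsum_eq, hP, norm_mul]
      simp only [mul_assoc, ← mul_pow]
      exact mul_le_of_le_one_right (norm_nonneg _) (hb _ (hmem w hw))
  have hlim (u : ℕ → ℂ) (t : Finset ℕ) :
      Filter.Tendsto (fun ρ : ℝ ↦ ∑ n ∈ t, ‖u n * (ρ : ℂ) ^ n‖ ^ 2) (nhdsWithin 1 (Set.Iio 1))
        (nhds (∑ n ∈ t, ‖u n‖ ^ 2)) := by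
    have : Continuous fun ρ : ℝ ↦ ∑ n ∈ t, ‖u n * (ρ : ℂ) ^ n‖ ^ 2 := by fun_prop
    simpa using (this.tendsto 1).mono_left nhdsWithin_le_nhds
  exact le_of_tendsto_of_tendsto (hlim _ s) (hlim _ _)
    (Filter.eventually_of_mem (Ioo_mem_nhdsLT one_pos) key)

/-- The contraction property tested on multipliers of the form `s + z ^ m * Q z`. -/
theorem sum_sq_norm_add_shift_le {f : ℂ → ℂ} {c : ℕ → ℂ}
    (hsum : ∀ z ∈ Metric.ball (0 : ℂ) 1, HasSum (fun n : ℕ => c n * z ^ n) (f z))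
    (hb : ∀ z ∈ Metric.ball (0 : ℂ) 1, ‖f z‖ ≤ 1) {m : ℕ} (hm : 1 ≤ m) (s : ℂ) {Q : ℕ → ℂ}
    {L : ℕ} (hQ : ∀ n, L ≤ n → Q n = 0) (K : ℕ) :
    ‖s‖ ^ 2 * ∑ k ∈ Finset.range m, ‖c k‖ ^ 2 +
        ∑ k ∈ Finset.range K,
          ‖s * c (m + k) + ∑ i ∈ Finset.range (k + 1), Q i * c (k - i)‖ ^ 2 ≤
      ‖s‖ ^ 2 + ∑ i ∈ Finset.range L, ‖Q i‖ ^ 2 := by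
  let q : ℕ → ℂ := fun j ↦ if j = 0 then s else if m ≤ j then Q (j - m) else 0
  have hq0 : q 0 = s := by simp [q]
  have hqlt (j : ℕ) (h0 : j ≠ 0) (hj : j < m) : q j = 0 := by simp [q, h0, hj.not_ge]
  have hqge (i : ℕ) : q (m + i) = Q i := by
    simp [q, show m ≠ 0 by lia]
  have hlow (g : ℕ → ℂ) (n : ℕ) (h1 : 1 ≤ n) (hn : n ≤ m) :
      ∑ k ∈ Finset.range n, q k * g k = s * g 0 := by
    rw [Finset.sum_eq_single_of_mem 0 (Finset.mem_range.mpr h1), hq0]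
    intro j hj h0
    rw [hqlt j h0 (by have := Finset.mem_range.mp hj; lia), zero_mul]
  have hsum_norm : ∑ n ∈ Finset.range (m + L), ‖q n‖ ^ 2 =
      ‖s‖ ^ 2 + ∑ i ∈ Finset.range L, ‖Q i‖ ^ 2 := by
    rw [Finset.sum_range_add]
    simp only [hqge, add_left_inj]
    rw [Finset.sum_eq_single_of_mem 0 (Finset.mem_range.mpr hm), hq0]
    intro j hj h0
    simp [hqlt j h0 (Finset.mem_range.mp hj)]
  have := sum_sq_norm_conv_le hsum hb (q := q) (M := m + L)
    (fun n hn ↦ by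
      obtain ⟨i, rfl⟩ := Nat.exists_eq_add_of_le (show m ≤ n by lia)
      rw [hqge, hQ i (by lia)]) (Finset.range (m + K))
  rw [hsum_norm, Finset.sum_range_add] at this
  convert this using 2
  · rw [Finset.mul_sum]
    refine Finset.sum_congr rfl fun k hk ↦ ?_
    rw [hlow (fun j ↦ c (k - j)) (k + 1) (by lia) (Finset.mem_range.mp hk), norm_mul, mul_pow,
      Nat.sub_zero]
  · refine Finset.sum_congr rfl fun k _ ↦ ?_
    rw [add_assoc m, Finset.sum_range_add _ m, hlow (fun j ↦ c (m + k - j)) m hm le_rfl]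
    simp [hqge, Nat.add_sub_add_left]

theorem norm_le_one_sub_of_forall {x : ℂ} {S : ℝ}
    (h : ∀ s t : ℂ, ‖s‖ ^ 2 * S + ‖s * x + t * S‖ ^ 2 ≤ ‖s‖ ^ 2 + ‖t‖ ^ 2 * S) :
    ‖x‖ ≤ 1 - S := by
  have h1 : S + ‖x‖ ^ 2 ≤ 1 := by simpa using h 1 0
  have h2 := h ((1 - S : ℝ) : ℂ) x
  rw [show ((1 - S : ℝ) : ℂ) * x + x * S = x by push_cast; ring, Complex.norm_real,
    Real.norm_eq_abs, sq_abs] at h2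
  have hx := norm_nonneg x
  rcases (show S ≤ 1 by nlinarith).eq_or_lt with rfl | hS
  · nlinarith
  · have : ‖x‖ ^ 2 ≤ (1 - S) ^ 2 := by
      refine le_of_mul_le_mul_left ?_ (sub_pos.mpr hS)
      nlinarith
    exact (pow_le_pow_iff_left₀ hx (by linarith) two_ne_zero).mp this

/-- Entries of a contraction `!![β, α; x, β]`. -/
theorem norm_add_sq_div_le_one_of_contraction {α β x : ℂ}
    (h : ∀ u : ℂ, ‖β + u * α‖ ^ 2 + ‖x + u * β‖ ^ 2 ≤ 1 + ‖u‖ ^ 2) :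
    ‖x‖ + ‖β‖ ^ 2 / (1 + ‖α‖) ≤ 1 := by
  set E := 1 - ‖α‖ ^ 2 - ‖β‖ ^ 2 with hE
  set C := 1 - ‖β‖ ^ 2 - ‖x‖ ^ 2 with hC
  set w := α * starRingEnd ℂ β + β * starRingEnd ℂ x with hw
  have hmain (t : ℝ) : 0 ≤ (E * ‖w‖ ^ 2) * (t * t) + (-2 * ‖w‖ ^ 2) * t + C := by
    have := h (t * starRingEnd ℂ w)
    simp only [hE, hC, hw, Complex.sq_norm, Complex.normSq_apply, Complex.add_re, Complex.add_im,
      Complex.mul_re, Complex.mul_im, Complex.conj_re, Complex.conj_im, Complex.ofReal_re,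
      Complex.ofReal_im] at this ⊢
    linarith
  have heven (t : ℝ) : 0 ≤ E * (t * t) + 0 * t + C := by
    have h1 := h t
    have h2 := h (-t)
    simp only [hE, hC, Complex.sq_norm, Complex.normSq_apply, Complex.add_re, Complex.add_im,
      Complex.mul_re, Complex.mul_im, Complex.neg_re, Complex.neg_im, Complex.ofReal_re,
      Complex.ofReal_im] at h1 h2 ⊢
    linarith
  have hC0 : 0 ≤ C := by simpa using heven 0
  have hE0 : 0 ≤ E := by
    by_contra! hneg
    have h1 := heven ((C + 1) / (-E) + 1)
    have h2 : 0 ≤ (C + 1) / (-E) := by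
      have := neg_pos.mpr hneg
      positivity
    have h3 : E * ((C + 1) / (-E)) = -(C + 1) := by have := hneg.ne; field_simp
    nlinarith [mul_nonneg h2 h2, mul_nonneg (neg_pos.mpr hneg).le (mul_nonneg h2 h2)]
  have hdisc : ‖w‖ ^ 2 ≤ E * C := by
    have := discrim_le_zero hmain
    rw [discrim] at this
    rcases (sq_nonneg ‖w‖).eq_or_lt with h0 | h0
    · rw [← h0]; positivity
    · refine le_of_mul_le_mul_left ?_ h0
      nlinarith
  have hlow : ‖β‖ ^ 2 * (‖α‖ - ‖x‖) ^ 2 ≤ ‖w‖ ^ 2 := by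
    have h1 := abs_norm_sub_norm_le (α * starRingEnd ℂ β) (-(β * starRingEnd ℂ x))
    rw [sub_neg_eq_add, ← hw, norm_neg, norm_mul, norm_mul, RCLike.norm_conj, RCLike.norm_conj] at h1
    calc ‖β‖ ^ 2 * (‖α‖ - ‖x‖) ^ 2 = |‖α‖ * ‖β‖ - ‖β‖ * ‖x‖| ^ 2 := by rw [sq_abs]; ring
      _ ≤ _ := by gcongr
  have hA := norm_nonneg α
  have hY := norm_nonneg x
  generalize ‖w‖ ^ 2 = W at *
  generalize ‖α‖ = A at *
  generalize ‖x‖ = Y at *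
  generalize ‖β‖ ^ 2 = B at *
  clear_value w
  suffices B ≤ (1 + A) * (1 - Y) by
    have := (div_le_iff₀' (show 0 < 1 + A by linarith)).mpr this
    linarith
  by_contra! hlt
  have hYA : A < Y := by nlinarith
  have hfac : 0 ≤ (B - (1 - A) * (1 + Y)) * (B - (1 + A) * (1 - Y)) := by
    simp only [hE, hC] at hdisc
    linarith
  have : 0 ≤ B - (1 - A) * (1 + Y) := nonneg_of_mul_nonneg_left hfac (by linarith)
  nlinarith

theorem norm_add_sq_div_le_of_forall {α b x : ℂ} {S : ℝ}
    (h : ∀ s u t : ℂ, ‖s‖ ^ 2 * S + ‖s * b + u * α‖ ^ 2 + ‖s * x + u * b + t * S‖ ^ 2 ≤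
      ‖s‖ ^ 2 + ‖u‖ ^ 2 + ‖t‖ ^ 2 * S) :
    ‖x‖ + ‖b‖ ^ 2 / (1 + ‖α‖) ≤ 1 - S := by
  have h1 : S + ‖b‖ ^ 2 + ‖x‖ ^ 2 ≤ 1 := by simpa using h 1 0 0
  rcases (show S ≤ 1 by nlinarith [sq_nonneg ‖x‖, sq_nonneg ‖b‖]).eq_or_lt with rfl | hS
  · have hx : ‖x‖ ^ 2 = 0 := by nlinarith [sq_nonneg ‖x‖, sq_nonneg ‖b‖]
    have hb : ‖b‖ ^ 2 = 0 := by nlinarith [sq_nonneg ‖x‖, sq_nonneg ‖b‖]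
    rw [hb, pow_eq_zero_iff two_ne_zero |>.mp hx]
    simp
  set d := √(1 - S) with hd
  have hd0 : 0 < d := Real.sqrt_pos.mpr (by linarith)
  have hd2 : d ^ 2 = 1 - S := Real.sq_sqrt (by linarith)
  have hdc : (d : ℂ) ≠ 0 := by exact_mod_cast hd0.ne'
  have hSd : S = 1 - d ^ 2 := by linarith
  have key := norm_add_sq_div_le_one_of_contraction (α := α) (β := b / d) (x := x / d ^ 2)
    fun u ↦ by
      have h2 := h (1 / d) u ((x / d + u * b) / d ^ 2)
      have e1 : (1 / d : ℂ) * b + u * α = b / d + u * α := by ring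
      have e2 : (1 / d : ℂ) * x + u * b + (x / d + u * b) / d ^ 2 * S =
          (x / d ^ 2 + u * (b / d)) / d := by
        rw [hSd]; push_cast; field_simp; ring
      have e3 : (x / d + u * b) / (d : ℂ) ^ 2 = (x / d ^ 2 + u * (b / d)) / d := by
        field_simp
      rw [e1, e2, e3, norm_div _ (d : ℂ), norm_div _ (d : ℂ)] at h2
      simp only [Complex.norm_real, Real.norm_of_nonneg hd0.le, norm_one, div_pow, one_pow] at h2
      generalize ‖x / d ^ 2 + u * (b / d)‖ ^ 2 = Z at h2 ⊢
      have e4 : 1 / d ^ 2 * S = 1 / d ^ 2 - 1 := by rw [hSd]; field_simp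
      have e5 : Z / d ^ 2 * S = Z / d ^ 2 - Z := by rw [hSd]; field_simp
      linarith
  simp only [norm_div, norm_pow, Complex.norm_real, Real.norm_of_nonneg hd0.le, div_pow] at key
  have hA := norm_nonneg α
  rw [← hd2]
  calc ‖x‖ + ‖b‖ ^ 2 / (1 + ‖α‖)
      = (‖x‖ / d ^ 2 + ‖b‖ ^ 2 / d ^ 2 / (1 + ‖α‖)) * d ^ 2 := by field_simp
    _ ≤ 1 * d ^ 2 := by gcongr
    _ = d ^ 2 := one_mul _

/-- Carlson's inequality for the coefficients of odd index. -/
theorem norm_coeff_odd_le {f : ℂ → ℂ} {c : ℕ → ℂ}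
    (hsum : ∀ z ∈ Metric.ball (0 : ℂ) 1, HasSum (fun n : ℕ => c n * z ^ n) (f z))
    (hb : ∀ z ∈ Metric.ball (0 : ℂ) 1, ‖f z‖ ≤ 1) (n : ℕ) :
    ‖c (2 * n + 1)‖ ≤ 1 - ∑ k ∈ Finset.range (n + 1), ‖c k‖ ^ 2 := by
  refine norm_le_one_sub_of_forall fun s t ↦ ?_
  have hrefl := Finset.sum_range_reflect (fun k ↦ ‖c k‖ ^ 2) (n + 1)
  simp only [add_tsub_cancel_right] at hrefl
  let Q : ℕ → ℂ := fun i ↦ if i < n + 1 then t * starRingEnd ℂ (c (n - i)) else 0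
  have hQ (i : ℕ) (hi : i ∈ Finset.range (n + 1)) : Q i = t * starRingEnd ℂ (c (n - i)) :=
    if_pos (Finset.mem_range.mp hi)
  have key := sum_sq_norm_add_shift_le hsum hb (Nat.le_add_left 1 n) s (Q := Q) (L := n + 1)
    (fun i hi ↦ if_neg hi.not_gt) (n + 1)
  have hsingle := Finset.single_le_sum (f := fun k ↦
      ‖s * c (n + 1 + k) + ∑ i ∈ Finset.range (k + 1), Q i * c (k - i)‖ ^ 2)
    (fun _ _ ↦ sq_nonneg _) (Finset.self_mem_range_succ n)
  have e1 : ∑ i ∈ Finset.range (n + 1), Q i * c (n - i) =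
      t * (∑ k ∈ Finset.range (n + 1), ‖c k‖ ^ 2 : ℝ) := by
    rw [← hrefl, Complex.ofReal_sum, Finset.mul_sum]
    refine Finset.sum_congr rfl fun i hi ↦ ?_
    rw [hQ i hi, mul_assoc, Complex.conj_mul', Complex.ofReal_pow]
  have e2 : ∑ i ∈ Finset.range (n + 1), ‖Q i‖ ^ 2 =
      ‖t‖ ^ 2 * ∑ k ∈ Finset.range (n + 1), ‖c k‖ ^ 2 := by
    rw [← hrefl, Finset.mul_sum]
    refine Finset.sum_congr rfl fun i hi ↦ ?_
    rw [hQ i hi, norm_mul, RCLike.norm_conj, mul_pow]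
  simp only [e1, show n + 1 + n = 2 * n + 1 by ring] at hsingle
  rw [e2] at key
  linarith

/-- Carlson's inequality for the coefficients of even index. -/
theorem norm_coeff_even_le {f : ℂ → ℂ} {c : ℕ → ℂ}
    (hsum : ∀ z ∈ Metric.ball (0 : ℂ) 1, HasSum (fun n : ℕ => c n * z ^ n) (f z))
    (hb : ∀ z ∈ Metric.ball (0 : ℂ) 1, ‖f z‖ ≤ 1) {n : ℕ} (hn : 1 ≤ n) :
    ‖c (2 * n)‖ + ‖c n‖ ^ 2 / (1 + ‖c 0‖) ≤ 1 - ∑ k ∈ Finset.range n, ‖c k‖ ^ 2 := by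
  refine norm_add_sq_div_le_of_forall fun s u t ↦ ?_
  have hrefl := Finset.sum_range_reflect (fun k ↦ ‖c k‖ ^ 2) n
  let Q : ℕ → ℂ := fun i ↦
    if i = 0 then u else if i < n + 1 then t * starRingEnd ℂ (c (n - i)) else 0
  have hQ0 : Q 0 = u := if_pos rfl
  have hQ (i : ℕ) (hi : i ∈ Finset.range n) :
      Q (i + 1) = t * starRingEnd ℂ (c (n - 1 - i)) := by
    have := Finset.mem_range.mp hi
    simp [Q, this, Nat.sub_sub, add_comm]
  have key := sum_sq_norm_add_shift_le hsum hb hn s (Q := Q) (L := n + 1)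
    (fun i hi ↦ by simp [Q, show i ≠ 0 by lia, show ¬ i ≤ n by lia]) (n + 1)
  have hpair := Finset.sum_le_sum_of_subset_of_nonneg (s := {0, n}) (t := Finset.range (n + 1))
    (f := fun k ↦ ‖s * c (n + k) + ∑ i ∈ Finset.range (k + 1), Q i * c (k - i)‖ ^ 2)
    (by intro k; simp; lia) (fun _ _ _ ↦ sq_nonneg _)
  have e1 : ∑ i ∈ Finset.range (n + 1), Q i * c (n - i) =
      u * c n + t * (∑ k ∈ Finset.range n, ‖c k‖ ^ 2 : ℝ) := by
    rw [Finset.sum_range_succ', hQ0, Nat.sub_zero, add_comm, ← hrefl, Complex.ofReal_sum,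
      Finset.mul_sum]
    congr 1
    refine Finset.sum_congr rfl fun i hi ↦ ?_
    rw [hQ i hi, show n - (i + 1) = n - 1 - i by lia, mul_assoc, Complex.conj_mul',
      Complex.ofReal_pow]
  have e2 : ∑ i ∈ Finset.range (n + 1), ‖Q i‖ ^ 2 =
      ‖u‖ ^ 2 + ‖t‖ ^ 2 * ∑ k ∈ Finset.range n, ‖c k‖ ^ 2 := by
    rw [Finset.sum_range_succ', hQ0, add_comm, ← hrefl, Finset.mul_sum]
    congr 1
    refine Finset.sum_congr rfl fun i hi ↦ ?_
    rw [hQ i hi, norm_mul, RCLike.norm_conj, mul_pow]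
  rw [Finset.sum_pair (show 0 ≠ n by lia)] at hpair
  simp only [e1, add_zero, zero_add, Finset.sum_range_one, hQ0, Nat.sub_zero,
    ← two_mul, ← add_assoc] at hpair
  rw [e2] at key
  linarith

/-- The Schwarz–Pick growth estimate. -/
theorem norm_le_div_of_norm_le_one {f : ℂ → ℂ}
    (hf : DifferentiableOn ℂ f (Metric.ball (0 : ℂ) 1))
    (hb : ∀ z ∈ Metric.ball (0 : ℂ) 1, ‖f z‖ ≤ 1) (h0 : ‖f 0‖ < 1) {z : ℂ} (hz : ‖z‖ < 1) :
    ‖f z‖ ≤ (‖z‖ + ‖f 0‖) / (1 + ‖f 0‖ * ‖z‖) := by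
  set α := f 0 with hα
  have hid (w : ℂ) : ‖1 - starRingEnd ℂ α * w‖ ^ 2 =
      ‖w - α‖ ^ 2 + (1 - ‖α‖ ^ 2) * (1 - ‖w‖ ^ 2) := by
    simp only [Complex.sq_norm, Complex.normSq_apply, Complex.sub_re, Complex.sub_im,
      Complex.mul_re, Complex.mul_im, Complex.conj_re, Complex.conj_im, Complex.one_re,
      Complex.one_im]
    ring
  have hne (w : ℂ) (hw : ‖w‖ ≤ 1) : 1 - starRingEnd ℂ α * w ≠ 0 := by
    intro h
    have : ‖starRingEnd ℂ α * w‖ < 1 := by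
      rw [norm_mul, RCLike.norm_conj]
      exact (mul_le_of_le_one_right (norm_nonneg _) hw).trans_lt h0
    rw [← sub_eq_zero.mp h, norm_one] at this
    exact lt_irrefl _ this
  have hα0 := norm_nonneg α
  have hsq (w : ℂ) (hw : ‖w‖ ≤ 1) : 0 ≤ (1 - ‖α‖ ^ 2) * (1 - ‖w‖ ^ 2) :=
    mul_nonneg (sub_nonneg.mpr (pow_le_one₀ hα0 h0.le))
      (sub_nonneg.mpr (pow_le_one₀ (norm_nonneg w) hw))
  have hschwarz := Complex.norm_le_norm_of_mapsTo_ball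
    (f := fun w ↦ (f w - α) / (1 - starRingEnd ℂ α * f w))
    ((hf.sub_const α).div ((hf.const_mul _).const_sub 1) fun w hw ↦ hne _ (hb w hw))
    (fun w hw ↦ by
      rw [mem_closedBall_zero_iff, norm_div,
        div_le_one (norm_pos_iff.mpr (hne _ (hb w hw)))]
      refine (pow_le_pow_iff_left₀ (norm_nonneg _) (norm_nonneg _) two_ne_zero).mp ?_
      rw [hid]
      linarith [hsq _ (hb w hw)])
    (by simp [← hα]) hz
  have hW : ‖f z‖ ≤ 1 := hb z (mem_ball_zero_iff.mpr hz)
  rw [norm_div, div_le_iff₀ (norm_pos_iff.mpr (hne _ hW))] at hschwarz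
  have hr := norm_nonneg z
  have hW0 := norm_nonneg (f z)
  have h1 : ‖f z - α‖ ^ 2 ≤ ‖z‖ ^ 2 * (‖f z - α‖ ^ 2 + (1 - ‖α‖ ^ 2) * (1 - ‖f z‖ ^ 2)) := by
    rw [← hid, ← mul_pow]
    gcongr
  have h2 : (‖f z‖ - ‖α‖) ^ 2 ≤ ‖f z - α‖ ^ 2 := by
    rw [← sq_abs]
    gcongr
    exact abs_norm_sub_norm_le _ _
  have h3 : (‖f z‖ - ‖α‖) ^ 2 ≤ (‖z‖ * (1 - ‖α‖ * ‖f z‖)) ^ 2 := by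
    have : 0 ≤ 1 - ‖z‖ ^ 2 := sub_nonneg.mpr (pow_le_one₀ hr hz.le)
    nlinarith [mul_le_mul_of_nonneg_left h2 this]
  have h4 : 0 ≤ ‖z‖ * (1 - ‖α‖ * ‖f z‖) :=
    mul_nonneg hr (sub_nonneg.mpr (mul_le_one₀ h0.le hW0 hW))
  rw [le_div_iff₀ (by positivity)]
  linarith [abs_le_of_sq_le_sq' h3 h4 |>.2]

/-- The refined Bohr inequality for the coefficients of a function bounded by one. -/
theorem refined_bohr_inequality {f : ℂ → ℂ} {c : ℕ → ℂ}
    (hsum : ∀ z ∈ Metric.ball (0 : ℂ) 1, HasSum (fun n : ℕ => c n * z ^ n) (f z))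
    (hb : ∀ z ∈ Metric.ball (0 : ℂ) 1, ‖f z‖ ≤ 1)
    {r : ℝ} (hr0 : 0 ≤ r) (hr1 : r < 1) :
    Summable (fun n : ℕ => ‖c (n + 1)‖ * r ^ (n + 1)) ∧
    Summable (fun n : ℕ => ‖c (n + 1)‖ ^ 2 * r ^ (2 * (n + 1))) ∧
    (∑' n : ℕ, ‖c (n + 1)‖ * r ^ (n + 1)) +
      (1 / (1 + ‖c 0‖) + r / (1 - r)) * ∑' n : ℕ, ‖c (n + 1)‖ ^ 2 * r ^ (2 * (n + 1)) ≤
        (1 - ‖c 0‖ ^ 2) * (r / (1 - r)) := by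
  let D : ℕ → ℝ := fun k ↦ 1 - ∑ j ∈ Finset.range (k + 1), ‖c j‖ ^ 2
  have hodd (k : ℕ) : ‖c (2 * k + 1)‖ ≤ D k := norm_coeff_odd_le hsum hb k
  have heven (k : ℕ) : ‖c (2 * k + 1 + 1)‖ ≤ D k - ‖c (k + 1)‖ ^ 2 / (1 + ‖c 0‖) :=
    le_sub_iff_add_le.mpr (norm_coeff_even_le hsum hb (Nat.le_add_left 1 k))
  have hDsucc (k : ℕ) : D (k + 1) = D k - ‖c (k + 1)‖ ^ 2 := by
    simp only [D]
    rw [Finset.sum_range_succ _ (k + 1)]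
    ring
  have hD0 (k : ℕ) : 0 ≤ D k := (norm_nonneg _).trans (hodd k)
  have hD1 (k : ℕ) : D k ≤ 1 := sub_le_self _ (Finset.sum_nonneg fun _ _ ↦ sq_nonneg _)
  have hc (k : ℕ) : ‖c (k + 1)‖ ^ 2 ≤ 1 := by linarith [hDsucc k, hD0 (k + 1), hD1 k]
  have hx1 : r ^ 2 < 1 := pow_lt_one₀ hr0 hr1 two_ne_zero
  have hgeom : Summable fun k : ℕ ↦ (r ^ 2) ^ k := summable_geometric_of_lt_one (sq_nonneg r) hx1
  have hsD : Summable fun k ↦ D k * (r ^ 2) ^ k :=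
    hgeom.of_nonneg_of_le (fun k ↦ mul_nonneg (hD0 k) (by positivity))
      fun k ↦ mul_le_of_le_one_left (by positivity) (hD1 k)
  have hsB : Summable fun k : ℕ ↦ ‖c (k + 1)‖ ^ 2 * r ^ (2 * (k + 1)) :=
    ((summable_nat_add_iff 1).mpr hgeom).of_nonneg_of_le (fun k ↦ by positivity) fun k ↦ by
      rw [pow_mul]
      exact mul_le_of_le_one_left (by positivity) (hc k)
  have hsA : Summable fun n : ℕ ↦ ‖c (n + 1)‖ * r ^ (n + 1) :=
    ((summable_nat_add_iff 1).mpr (summable_geometric_of_lt_one hr0 hr1)).of_nonneg_of_le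
      (fun k ↦ by positivity) fun k ↦ mul_le_of_le_one_left (by positivity)
        ((pow_le_one_iff_of_nonneg (norm_nonneg _) two_ne_zero).mp (hc k))
  refine ⟨hsA, hsB, ?_⟩
  set B := ∑' k : ℕ, ‖c (k + 1)‖ ^ 2 * r ^ (2 * (k + 1)) with hB
  set X := ∑' k, D k * (r ^ 2) ^ k with hX
  have hXrec : X = (1 - ‖c 0‖ ^ 2) + (r ^ 2 * X - B) := by
    have h0 : D 0 * (r ^ 2) ^ 0 = 1 - ‖c 0‖ ^ 2 := by simp [D]
    have h1 := hsD.tsum_eq_zero_add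
    rw [h0] at h1
    refine h1.trans (congrArg _ ?_)
    rw [hX, hB, ← tsum_mul_left, ← (hsD.mul_left _).tsum_sub hsB]
    refine tsum_congr fun k ↦ ?_
    rw [hDsucc, pow_mul]
    ring
  have hs_even : Summable fun k : ℕ ↦ ‖c (2 * k + 1)‖ * r ^ (2 * k + 1) :=
    hsA.comp_injective (i := fun k ↦ 2 * k) fun _ _ h ↦ by simpa using h
  have hs_odd : Summable fun k : ℕ ↦ ‖c (2 * k + 1 + 1)‖ * r ^ (2 * k + 1 + 1) :=
    hsA.comp_injective (i := fun k ↦ 2 * k + 1) fun _ _ h ↦ by simpa using h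
  have hle_odd : ∑' k : ℕ, ‖c (2 * k + 1)‖ * r ^ (2 * k + 1) ≤ r * X := by
    rw [hX, ← tsum_mul_left]
    refine hs_even.tsum_le_tsum (fun k ↦ ?_) (hsD.mul_left r)
    calc ‖c (2 * k + 1)‖ * r ^ (2 * k + 1) ≤ D k * r ^ (2 * k + 1) := by gcongr; exact hodd k
      _ = r * (D k * (r ^ 2) ^ k) := by ring
  have hle_even : ∑' k : ℕ, ‖c (2 * k + 1 + 1)‖ * r ^ (2 * k + 1 + 1) ≤
      r ^ 2 * X - 1 / (1 + ‖c 0‖) * B := by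
    rw [hX, hB, ← tsum_mul_left, ← tsum_mul_left, ← (hsD.mul_left _).tsum_sub (hsB.mul_left _)]
    refine hs_odd.tsum_le_tsum (fun k ↦ ?_) ((hsD.mul_left _).sub (hsB.mul_left _))
    calc ‖c (2 * k + 1 + 1)‖ * r ^ (2 * k + 1 + 1)
        ≤ (D k - ‖c (k + 1)‖ ^ 2 / (1 + ‖c 0‖)) * r ^ (2 * k + 1 + 1) := by
          gcongr
          exact heven k
      _ = _ := by ring
  have hsplit := tsum_even_add_odd (f := fun n : ℕ ↦ ‖c (n + 1)‖ * r ^ (n + 1)) hs_even hs_odd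
  have h1r : 0 < 1 - r := sub_pos.mpr hr1
  have hXr : r * X + r ^ 2 * X = (1 - ‖c 0‖ ^ 2 - B) * (r / (1 - r)) := by
    field_simp
    linear_combination r * hXrec
  linarith

/-- Lemma 3 of Liu–Ponnusamy: if `f` is analytic on the unit disk with `|f| ≤ 1`,
Taylor expansion `f(z) = Σ aₙ zⁿ`, `a = |a₀| < 1`, `p > 0`, and
`A_{a,p}(r) = [1-(2-a²)r](1+ar)^p - (1-r)(r+a)^p ≥ 0` for `r ∈ [0,1)`, then for
`|z| = r`,
`|f(z)|^p + Σ_{n≥1} |aₙ| rⁿ + (1/(1+a) + r/(1-r)) Σ_{n≥1} |aₙ|² r^{2n} ≤ 1`. -/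
theorem stmt_13 (f : ℂ → ℂ) (c : ℕ → ℂ)
    (hf : DifferentiableOn ℂ f (Metric.ball (0 : ℂ) 1))
    (hsum : ∀ z ∈ Metric.ball (0 : ℂ) 1, HasSum (fun n : ℕ => c n * z ^ n) (f z))
    (hb : ∀ z ∈ Metric.ball (0 : ℂ) 1, ‖f z‖ ≤ 1)
    (ha : ‖c 0‖ < 1) (p : ℝ) (hp0 : 0 < p)
    (r : ℝ) (hr0 : 0 ≤ r) (hr1 : r < 1)
    (hA : 0 ≤ (1 - (2 - ‖c 0‖ ^ 2) * r) * (1 + ‖c 0‖ * r) ^ p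
            - (1 - r) * (r + ‖c 0‖) ^ p)
    (z : ℂ) (hz : ‖z‖ = r) :
    Summable (fun n : ℕ => ‖c (n + 1)‖ * r ^ (n + 1)) ∧
    Summable (fun n : ℕ => ‖c (n + 1)‖ ^ 2 * r ^ (2 * (n + 1))) ∧
    ‖f z‖ ^ p + (∑' n : ℕ, ‖c (n + 1)‖ * r ^ (n + 1)) +
      (1 / (1 + ‖c 0‖) + r / (1 - r)) *
        ∑' n : ℕ, ‖c (n + 1)‖ ^ 2 * r ^ (2 * (n + 1)) ≤ 1 := by
  obtain ⟨hs1, hs2, hbohr⟩ := refined_bohr_inequality hsum hb hr0 hr1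
  refine ⟨hs1, hs2, ?_⟩
  have hf0 : f 0 = c 0 := by
    refine (hsum 0 (by simp)).unique ?_
    simpa using hasSum_single (f := fun n : ℕ ↦ c n * (0 : ℂ) ^ n) 0 (by simp +contextual)
  have hfz := norm_le_div_of_norm_le_one hf hb (hf0 ▸ ha) (hz ▸ hr1 : ‖z‖ < 1)
  rw [hf0, hz] at hfz
  have h1r : 0 < 1 - r := sub_pos.mpr hr1
  have hc0 := norm_nonneg (c 0)
  have hpow : ‖f z‖ ^ p ≤ (1 - (2 - ‖c 0‖ ^ 2) * r) / (1 - r) := by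
    refine (Real.rpow_le_rpow (norm_nonneg _) hfz hp0.le).trans ?_
    rw [Real.div_rpow (by positivity) (by positivity), div_le_div_iff₀ (by positivity) h1r]
    linarith
  have : (1 - (2 - ‖c 0‖ ^ 2) * r) / (1 - r) = 1 - (1 - ‖c 0‖ ^ 2) * (r / (1 - r)) := by
    field_simp
    ring
  linarith
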